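/- The classes ψ are multiplicative under concatenation for the shuffle product *: each ψ^{𝐢,𝐚}_{μ(•)} is a Laurent polynomial in the x variables and the arrow variables t_b, symmetric in the variables at each vertex, and if (𝐢′, 𝐚′, μ′(•)) and (𝐢″, 𝐚″, μ″(•)) are two triples as above and (𝐢, 𝐚, μ(•)) is obtained by concatenating 𝐢 = 𝐢′𝐢″, 𝐚 = 𝐚′𝐚″, μ(•) = μ′(•)μ″(•), then ψ^{𝐢,𝐚}_{μ(•)} = ψ^{𝐢′,𝐚′}_{μ′(•)} * ψ^{𝐢″,𝐚″}_{μ″(•)}, where the two factors are taken in disjoint sets of variables for the dimension vectors ν•(𝐢′,𝐚′) and ν•(𝐢″,𝐚″) and the blocks of the concatenated data are those of 𝐢′,𝐚′ followed by those of 𝐢″,𝐚″. -/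

import Mathlib

open scoped BigOperators

namespace QKS

/-- The coordinates of `X• = ∏_i ℤ^{ν^{(i)}}`, indexed by their block `k` (with `i_k = i`)
and position `p` within the block.  The coordinates at vertex `i` are those with
`iseq k = i`, ordered lexicographically by `(k, p)`. -/
abbrev Coord (m : ℕ) (a : Fin m → ℕ) : Type := (k : Fin m) × Fin (a k)

/-- The (strict) order on coordinates: lexicographic by block, then position. -/
abbrev coordLT {m : ℕ} {a : Fin m → ℕ} (x y : Coord m a) : Prop :=
  x.1 < y.1 ∨ (x.1 = y.1 ∧ (x.2 : ℕ) < (y.2 : ℕ))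

variable {Q0 Q1 : Type} [Fintype Q0] [Fintype Q1] [DecidableEq Q0] [DecidableEq Q1]
variable {m : ℕ}

/-- The staircase `ρ• ∈ X•`: at each vertex, its coordinates are
`ν^{(i)} - 1, ν^{(i)} - 2, …, 1, 0` read in the order of the coordinates at that vertex;
equivalently, `ρ x` is the number of coordinates at the vertex of `x` that are greater
than `x`. -/
def rho (iseq : Fin m → Q0) (a : Fin m → ℕ) : Coord m a → ℤ := fun x =>
  ((Finset.univ.filter (fun y : Coord m a => iseq y.1 = iseq x.1 ∧ coordLT x y)).card : ℤ)

/-- The index set `R_{𝐢,𝐚}`: triples (arrow `b`, coordinate `(k,p)`, coordinate `(ℓ,q)`)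
with `k < ℓ`, `tb = i_k` and `hb = i_ℓ`. -/
abbrev RootSet (hd tl : Q1 → Q0) (iseq : Fin m → Q0) (a : Fin m → ℕ) : Type :=
  {z : Q1 × Coord m a × Coord m a //
    z.2.1.1 < z.2.2.1 ∧ tl z.1 = iseq z.2.1.1 ∧ hd z.1 = iseq z.2.2.1}

/-- `ᾱ = e(ℓ)_q − e(k)_p ∈ X•` for a root `α = α^b_{p,q}(k,ℓ)`. -/
def alphaBar {hd tl : Q1 → Q0} {iseq : Fin m → Q0} {a : Fin m → ℕ}
    (z : RootSet hd tl iseq a) : Coord m a → ℤ := fun x =>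
  (if x = z.1.2.2 then 1 else 0) - (if x = z.1.2.1 then 1 else 0)

/-- The group `S• = ∏_i S_{ν^{(i)}}`, realized as permutations of the coordinates
preserving the vertex. -/
abbrev VertexPerm (iseq : Fin m → Q0) (a : Fin m → ℕ) : Type :=
  {σ : Equiv.Perm (Coord m a) // ∀ x : Coord m a, iseq (σ x).1 = iseq x.1}

/-- The quiver Kostka-Shoji polynomial `𝒦^{𝐢,𝐚}_{λ•,μ(•)}(t_{Q₁})`, defined by the signed
sum over `w• ∈ S•` of, for each `w•`, the (finite) sum of the monomials
`∏_α t_α^{m(α)}` over all Kostant partitions `m : R_{𝐢,𝐚} → ℤ_{≥0}` with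
`Σ_α m(α) ᾱ = (w•)⁻¹(λ•+ρ•) − (μ•+ρ•)`. -/
noncomputable def KS (hd tl : Q1 → Q0) (iseq : Fin m → Q0) (a : Fin m → ℕ)
    (lam mu : Coord m a → ℤ) : MvPolynomial Q1 ℤ :=
  ∑ σ : VertexPerm iseq a,
    ((Equiv.Perm.sign σ.1 : ℤˣ) : ℤ) •
      ∑ᶠ f : {f : RootSet hd tl iseq a → ℕ //
          ∀ x : Coord m a,
            (∑ α : RootSet hd tl iseq a, (f α : ℤ) * alphaBar α x)
              = (lam (σ.1 x) + rho iseq a (σ.1 x)) - (mu x + rho iseq a x)},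
        ∏ α : RootSet hd tl iseq a, MvPolynomial.X α.1.1 ^ f.1 α

/-- `μ(•)` is a sequence of weakly decreasing vectors `μ(k) ∈ ℤ^{a_k}`. -/
def BlockDecreasing {a : Fin m → ℕ} (mu : Coord m a → ℤ) : Prop :=
  ∀ (k : Fin m) (p q : Fin (a k)), p ≤ q → mu ⟨k, q⟩ ≤ mu ⟨k, p⟩

/-- `λ•` is a tuple of weakly decreasing vectors `λ^{(i)} ∈ ℤ^{ν^{(i)}}`: weakly decreasing
along the coordinates of each vertex. -/
def VertexDecreasing (iseq : Fin m → Q0) {a : Fin m → ℕ} (lam : Coord m a → ℤ) : Prop :=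
  ∀ x y : Coord m a, iseq x.1 = iseq y.1 → coordLT x y → lam y ≤ lam x

end QKS

open scoped BigOperators

namespace Shuffle

noncomputable section

/-- The field of rational functions in the variables indexed by `V`: the fraction field of
the multivariate polynomial ring.  Laurent polynomials in the variables `X v` are viewed
inside this field, and the geometric series `(1 - t·x/y)⁻¹` is the honest inverse here. -/
abbrev FF (V : Type) : Type := FractionRing (MvPolynomial V ℚ)

/-- The variable `X v`, viewed in the rational function field. -/
def xv {V : Type} (v : V) : FF V := algebraMap (MvPolynomial V ℚ) (FF V) (MvPolynomial.X v)

/-- The action of a permutation of the variables on the rational function field,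
by renaming variables. -/
def act {V : Type} (σ : Equiv.Perm V) : FF V →+* FF V :=
  IsFractionRing.lift (g := (algebraMap (MvPolynomial V ℚ) (FF V)).comp
      (MvPolynomial.rename σ : MvPolynomial V ℚ →ₐ[ℚ] MvPolynomial V ℚ).toRingHom)
    ((IsFractionRing.injective (MvPolynomial V ℚ) (FF V)).comp
      (MvPolynomial.rename_injective σ σ.injective))

variable {X Q0 Q1 : Type} [Fintype X] [DecidableEq X] [Fintype Q0] [DecidableEq Q0]
  [Fintype Q1] [DecidableEq Q1]

/-- The `x`-variable indexed by `x : X`, inside the field of rational functions in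
the `x`-variables and the arrow variables. -/
def xx (Q1 : Type) (x : X) : FF (X ⊕ Q1) := xv (Sum.inl x)

/-- The arrow variable `t_b`. -/
def tt (X : Type) (b : Q1) : FF (X ⊕ Q1) := xv (Sum.inr b)

/-- Extension of a permutation of the `x`-variables by the identity on the arrow
variables. -/
def permExt (Q1 : Type) (σ : Equiv.Perm X) : Equiv.Perm (X ⊕ Q1) :=
  Equiv.sumCongr σ (Equiv.refl Q1)

/-- The monomial `x^β` with integer exponents. -/
def xmon (Q1 : Type) (β : X → ℤ) : FF (X ⊕ Q1) := ∏ x : X, (xx Q1 x) ^ (β x)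

/-- The staircase exponent for the variables in `S`: each variable `x ∈ S` gets the number
of variables in `S` at the same vertex that come after it (so at each vertex the variables
of `S` receive `ν - 1, ν - 2, …, 1, 0` in their listed order). -/
def rhoS (vert : X → Q0) (lt : X → X → Prop) [DecidableRel lt] (S : Finset X) : X → ℤ :=
  fun x => if x ∈ S then ((S.filter (fun y => vert y = vert x ∧ lt x y)).card : ℤ) else 0

/-- The antisymmetrizer `J• = Σ (−1)^{w•} w•` over the permutations of the variables in `S`
preserving the vertex of each variable (and fixing all other variables). -/
def Jsym (vert : X → Q0) (S : Finset X) (f : FF (X ⊕ Q1)) : FF (X ⊕ Q1) :=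
  ∑ σ ∈ Finset.univ.filter (fun σ : Equiv.Perm X =>
      (∀ x, vert (σ x) = vert x) ∧ ∀ x ∉ S, σ x = x),
    ((Equiv.Perm.sign σ : ℤˣ) : ℤ) • act (permExt Q1 σ) f

/-- The Demazure symmetrizer `D_{w₀•}(f) = J•(x^{ρ•})⁻¹ · J•(x^{ρ•} f)` over the variables
in `S`, symmetrizing at each vertex. -/
def Dem (vert : X → Q0) (lt : X → X → Prop) [DecidableRel lt] (S : Finset X)
    (f : FF (X ⊕ Q1)) : FF (X ⊕ Q1) :=
  (Jsym vert S (xmon Q1 (rhoS vert lt S)))⁻¹ * Jsym vert S (xmon Q1 (rhoS vert lt S) * f)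

/-- The subring of Laurent polynomials over `ℤ[t_b^{±1} : b ∈ Q₁]` in the `x`-variables
belonging to `S`. -/
def LaurentIn (Q1 : Type) [Fintype Q1] (S : Finset X) : Subring (FF (X ⊕ Q1)) :=
  Subring.closure
    ((fun x : X => xx Q1 x) '' ↑S ∪ (fun x : X => (xx Q1 x)⁻¹) '' ↑S
      ∪ Set.range (tt X (Q1 := Q1)) ∪ Set.range (fun b : Q1 => (tt X b)⁻¹))

/-- `f` is symmetric in the variables of `S` at each vertex. -/
def SymmOn (Q1 : Type) (vert : X → Q0) (S : Finset X) (f : FF (X ⊕ Q1)) : Prop :=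
  ∀ σ : Equiv.Perm X, (∀ x, vert (σ x) = vert x) → (∀ x ∉ S, σ x = x) →
    act (permExt Q1 σ) f = f

/-- The shuffle product `f * g` of `f` (in the variables of `A`) and `g` (in the variables
of `B`): `D_{w₀•}(f · g · ∏_b ∏_{y ∈ B, vert y = tb} ∏_{x ∈ A, vert x = hb}
(1 − t_b y/x))`. -/
def starMul (vert : X → Q0) (hd tl : Q1 → Q0) (lt : X → X → Prop) [DecidableRel lt]
    (A B : Finset X) (f g : FF (X ⊕ Q1)) : FF (X ⊕ Q1) :=
  Dem vert lt (A ∪ B) (f * g *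
    ∏ b : Q1, ∏ y ∈ B.filter (fun y => vert y = tl b), ∏ x ∈ A.filter (fun x => vert x = hd b),
      (1 - tt X b * xx Q1 y / xx Q1 x))

/-- The shuffle product `f ⋆ g` of `f` (in the variables of `A`) and `g` (in the variables
of `B`): `D_{w₀•}(f · g · ∏_b ∏_{x ∈ A, vert x = tb} ∏_{y ∈ B, vert y = hb}
(1 − t_b x/y)⁻¹)`. -/
def starGeom (vert : X → Q0) (hd tl : Q1 → Q0) (lt : X → X → Prop) [DecidableRel lt]
    (A B : Finset X) (f g : FF (X ⊕ Q1)) : FF (X ⊕ Q1) :=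
  Dem vert lt (A ∪ B) (f * g *
    ∏ b : Q1, ∏ x ∈ A.filter (fun x => vert x = tl b), ∏ y ∈ B.filter (fun y => vert y = hd b),
      (1 - tt X b * xx Q1 x / xx Q1 y)⁻¹)

end

end Shuffle

namespace QHL

open QKS Shuffle

noncomputable section

instance {m : ℕ} {a : Fin m → ℕ} : DecidableRel (fun x y : Coord m a => coordLT x y) :=
  fun _ _ => inferInstanceAs (Decidable (_ ∨ _))

variable {Q0 Q1 : Type} [Fintype Q0] [DecidableEq Q0] [Fintype Q1] [DecidableEq Q1]
variable {m : ℕ} {a : Fin m → ℕ}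

/-- The block `x(k)` of variables. -/
def blkF (m : ℕ) (a : Fin m → ℕ) (k : ℕ) : Finset (Coord m a) :=
  Finset.univ.filter (fun x => (x.1 : ℕ) = k)

/-- The variables of the blocks before block `k`. -/
def headF (m : ℕ) (a : Fin m → ℕ) (k : ℕ) : Finset (Coord m a) :=
  Finset.univ.filter (fun x => (x.1 : ℕ) < k)

/-- The Schur (Laurent) polynomial `s_{μ(k)}[x(k)] = J(x(k)^{μ(k)+ρ})/J(x(k)^ρ)` in the
variables of block `k`, realized as the Demazure symmetrizer of the monomial `x(k)^{μ(k)}`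
over the block-`k` variables. -/
def schurBlk (Q1 : Type) [Fintype Q1] [DecidableEq Q1] (iseq : Fin m → Q0)
    (mu : Coord m a → ℤ) (k : ℕ) : FF (Coord m a ⊕ Q1) :=
  Dem (fun x => iseq x.1) (fun x y => coordLT x y) (blkF m a k)
    (xmon Q1 (fun x => if (x.1 : ℕ) = k then mu x else 0))

/-- The iterated (left to right) shuffle product
`s_{μ(1)}[x(1)] ⋆ s_{μ(2)}[x(2)] ⋆ ⋯ ⋆ s_{μ(k)}[x(k)]` of the Schur polynomials of the
first `k` blocks. -/
def starAllL (hd tl : Q1 → Q0) (iseq : Fin m → Q0) (mu : Coord m a → ℤ) :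
    ℕ → FF (Coord m a ⊕ Q1)
  | 0 => 1
  | (k + 1) =>
      starGeom (fun x => iseq x.1) hd tl (fun x y => coordLT x y) (headF m a k) (blkF m a k)
        (starAllL hd tl iseq mu k) (schurBlk Q1 iseq mu k)

/-- The factor `B_{𝐢,𝐚}`, restricted to the variables in `S`:
`∏_{k<ℓ} ∏_{b : i_k → i_ℓ} ∏_{y ∈ x(k), z ∈ x(ℓ)} (1 − t_b y/z)⁻¹`. -/
def BfieldS (hd tl : Q1 → Q0) (iseq : Fin m → Q0) (a : Fin m → ℕ)
    (S : Finset (Coord m a)) : FF (Coord m a ⊕ Q1) :=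
  ∏ x ∈ S, ∏ y ∈ S, ∏ b : Q1,
    if x.1 < y.1 ∧ tl b = iseq x.1 ∧ hd b = iseq y.1
    then (1 - tt (Coord m a) b * xx Q1 x / xx Q1 y)⁻¹ else 1

/-- The quiver Hall-Littlewood series `χ^{𝐢,𝐚}_{μ(•)} = D_{w₀•}(x^{μ•} B_{𝐢,𝐚})`
(in the rational-function model), for the data restricted to the variables in `S`. -/
def chiF (hd tl : Q1 → Q0) (iseq : Fin m → Q0) (a : Fin m → ℕ) (mu : Coord m a → ℤ)
    (S : Finset (Coord m a)) : FF (Coord m a ⊕ Q1) :=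
  Dem (fun x => iseq x.1) (fun x y => coordLT x y) S
    (xmon Q1 (fun x => if x ∈ S then mu x else 0) * BfieldS hd tl iseq a S)

end

end QHL


namespace QHL

open QKS Shuffle

noncomputable section

variable {Q0 Q1 : Type} [Fintype Q0] [DecidableEq Q0] [Fintype Q1] [DecidableEq Q1]
variable {m : ℕ} {a : Fin m → ℕ}

/-- The variables of the blocks from block `k` on. -/
def tailF (m : ℕ) (a : Fin m → ℕ) (k : ℕ) : Finset (Coord m a) :=
  Finset.univ.filter (fun x => k ≤ (x.1 : ℕ))

/-- The character `C_{ν•}` of `Sym(E_{ν•}^∨)`, restricted to the variables in `S`: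
`∏_b ∏_{x at vertex hb} ∏_{y at vertex tb} (1 − t_b y/x)`. -/
def CfieldS (hd tl : Q1 → Q0) (iseq : Fin m → Q0) (a : Fin m → ℕ)
    (S : Finset (Coord m a)) : FF (Coord m a ⊕ Q1) :=
  ∏ b : Q1, ∏ x ∈ S.filter (fun x => iseq x.1 = hd b),
    ∏ y ∈ S.filter (fun y => iseq y.1 = tl b),
      (1 - tt (Coord m a) b * xx Q1 y / xx Q1 x)

/-- The pushforward class `ψ^{𝐢,𝐚}_{μ(•)} = D_{w₀•}(x^{μ(•)} C_{ν•} B_{𝐢,𝐚})`, for the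
data restricted to the variables in `S`. -/
def psiF (hd tl : Q1 → Q0) (iseq : Fin m → Q0) (a : Fin m → ℕ) (mu : Coord m a → ℤ)
    (S : Finset (Coord m a)) : FF (Coord m a ⊕ Q1) :=
  Dem (fun x => iseq x.1) (fun x y => coordLT x y) S
    (xmon Q1 (fun x => if x ∈ S then mu x else 0)
      * (CfieldS hd tl iseq a S * BfieldS hd tl iseq a S))

end

end QHL

namespace Shuffle

noncomputable section

section Action

variable {V : Type}

lemma act_xv (σ : Equiv.Perm V) (v : V) : act σ (xv v) = xv (σ v) := by
  simp [act, xv]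

lemma xv_ne_zero (v : V) : (xv v : FF V) ≠ 0 := by
  simp [xv]

lemma xv_injective : Function.Injective (xv : V → FF V) := by
  intro v w h
  exact MvPolynomial.X_injective (IsFractionRing.injective (MvPolynomial V ℚ) (FF V) h)

lemma act_comp (σ τ : Equiv.Perm V) : (act σ).comp (act τ) = act (σ * τ) := by
  apply IsLocalization.ringHom_ext (nonZeroDivisors (MvPolynomial V ℚ))
  apply MvPolynomial.ringHom_ext
  · intro r
    simp [act]
  · intro v
    change act σ (act τ (xv v)) = act (σ * τ) (xv v)
    simp [act_xv]

lemma act_mul (σ τ : Equiv.Perm V) (f : FF V) : act σ (act τ f) = act (σ * τ) f :=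
  RingHom.congr_fun (act_comp σ τ) f

end Action

variable {X Q0 Q1 : Type}

lemma permExt_mul (σ τ : Equiv.Perm X) :
    permExt Q1 σ * permExt Q1 τ = permExt Q1 (σ * τ) := by
  ext x
  rcases x with x | x <;> rfl

lemma act_permExt_mul (σ τ : Equiv.Perm X) (f : FF (X ⊕ Q1)) :
    act (permExt Q1 σ) (act (permExt Q1 τ) f) = act (permExt Q1 (σ * τ)) f := by
  rw [act_mul, permExt_mul]

@[simp] lemma act_xx (σ : Equiv.Perm X) (x : X) :
    act (permExt Q1 σ) (xx Q1 x) = xx Q1 (σ x) := act_xv _ _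

@[simp] lemma act_tt (σ : Equiv.Perm X) (b : Q1) :
    act (permExt Q1 σ) (tt X b) = tt X b := act_xv _ _

lemma xx_ne_zero (x : X) : xx Q1 x ≠ 0 := xv_ne_zero _

lemma xx_injective : Function.Injective (xx Q1 : X → FF (X ⊕ Q1)) :=
  xv_injective.comp Sum.inl_injective

lemma one_sub_ne_zero (b : Q1) (x y : X) : 1 - tt X b * xx Q1 x / xx Q1 y ≠ 0 := by
  intro h
  rw [sub_eq_zero, eq_div_iff (xx_ne_zero y), one_mul] at h
  have h' : (MvPolynomial.X (Sum.inl y) : MvPolynomial (X ⊕ Q1) ℚ)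
      = MvPolynomial.X (Sum.inr b) * MvPolynomial.X (Sum.inl x) := by
    apply IsFractionRing.injective (MvPolynomial (X ⊕ Q1) ℚ) (FF (X ⊕ Q1))
    rw [map_mul]
    exact h
  have := congrArg MvPolynomial.totalDegree h'
  rw [MvPolynomial.totalDegree_mul_of_isDomain (MvPolynomial.X_ne_zero _)
    (MvPolynomial.X_ne_zero _)] at this
  simp at this

/-- The permutations over which `Jsym vert S` is summed: they preserve the vertex of each
variable and fix the variables outside `S`. -/
def vertexStabilizer (vert : X → Q0) (S : Finset X) : Subgroup (Equiv.Perm X) where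
  carrier := {σ | (∀ x, vert (σ x) = vert x) ∧ ∀ x ∉ S, σ x = x}
  one_mem' := by simp
  mul_mem' := by
    rintro σ τ ⟨h1, h2⟩ ⟨h3, h4⟩
    refine ⟨fun x => by simp [h1, h3], fun x hx => by simp [h4 x hx, h2 x hx]⟩
  inv_mem' := by
    rintro σ ⟨h1, h2⟩
    refine ⟨fun x => ?_, fun x hx => ?_⟩
    · simpa using (h1 (σ⁻¹ x)).symm
    · rw [Equiv.Perm.inv_eq_iff_eq, h2 x hx]

lemma mem_vertexStabilizer {vert : X → Q0} {S : Finset X} {σ : Equiv.Perm X} :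
    σ ∈ vertexStabilizer vert S ↔ (∀ x, vert (σ x) = vert x) ∧ ∀ x ∉ S, σ x = x := Iff.rfl

lemma apply_mem_of_mem_vertexStabilizer {vert : X → Q0} {S : Finset X} {σ : Equiv.Perm X}
    (hσ : σ ∈ vertexStabilizer vert S) {x : X} : σ x ∈ S ↔ x ∈ S := by
  constructor
  · intro h
    by_contra hx
    rw [hσ.2 x hx] at h
    exact hx h
  · intro h
    by_contra hx
    have := σ.injective (hσ.2 _ hx)
    rw [this] at hx
    exact hx h

lemma vertexStabilizer_mono {vert : X → Q0} {S T : Finset X} (h : S ⊆ T) :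
    vertexStabilizer vert S ≤ vertexStabilizer vert T :=
  fun _ hσ => ⟨hσ.1, fun x hx => hσ.2 x fun hS => hx (h hS)⟩

lemma commute_of_disjoint {vert : X → Q0} {S T : Finset X} (h : Disjoint S T)
    {σ τ : Equiv.Perm X} (hσ : σ ∈ vertexStabilizer vert S)
    (hτ : τ ∈ vertexStabilizer vert T) : Commute σ τ := by
  apply Equiv.Perm.Disjoint.commute
  intro x
  by_cases hx : x ∈ S
  · exact Or.inr (hτ.2 x (Finset.disjoint_left.mp h hx))
  · exact Or.inl (hσ.2 x hx)

set_option linter.unusedSectionVars false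

variable [Fintype X] [DecidableEq X] [DecidableEq Q0]

lemma act_xmon (σ : Equiv.Perm X) (β : X → ℤ) :
    act (permExt Q1 σ) (xmon Q1 β) = ∏ x, xx Q1 (σ x) ^ β x := by
  simp [xmon]

lemma act_xmon_of_invariant {σ : Equiv.Perm X} {β : X → ℤ} (h : ∀ x, β (σ x) = β x) :
    act (permExt Q1 σ) (xmon Q1 β) = xmon Q1 β := by
  rw [act_xmon, xmon, ← Equiv.prod_comp σ (fun x => xx Q1 x ^ β x)]
  simp [h]

lemma xmon_add (β γ : X → ℤ) : xmon Q1 (β + γ) = xmon Q1 β * xmon Q1 γ := by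
  simp [xmon, zpow_add₀ (xx_ne_zero _), Finset.prod_mul_distrib]

/-- The sign of a permutation, as a rational function. -/
def sgn (Q1 : Type) (σ : Equiv.Perm X) : FF (X ⊕ Q1) := (((Equiv.Perm.sign σ : ℤˣ) : ℤ) : FF _)

lemma sgn_mul (σ τ : Equiv.Perm X) : sgn Q1 (σ * τ) = sgn Q1 σ * sgn Q1 τ := by
  simp [sgn]

lemma sgn_mul_self (σ : Equiv.Perm X) : sgn Q1 σ * sgn Q1 σ = 1 := by
  rcases Int.units_eq_one_or (Equiv.Perm.sign σ) with h | h <;> simp [sgn, h]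

lemma sgn_ne_zero (σ : Equiv.Perm X) : sgn Q1 σ ≠ 0 :=
  left_ne_zero_of_mul_eq_one (sgn_mul_self σ)

lemma sgn_inv (σ : Equiv.Perm X) : sgn Q1 σ⁻¹ = sgn Q1 σ := by
  simp [sgn]

lemma inv_sgn (σ : Equiv.Perm X) : (sgn Q1 σ)⁻¹ = sgn Q1 σ :=
  inv_eq_of_mul_eq_one_left (sgn_mul_self σ)

lemma act_sgn (σ τ : Equiv.Perm X) : act (permExt Q1 σ) (sgn Q1 τ) = sgn Q1 τ := by
  simp [sgn]

/-- The finite set of permutations over which `Jsym vert S` is summed. -/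
def vertexPerms (vert : X → Q0) (S : Finset X) : Finset (Equiv.Perm X) :=
  Finset.univ.filter (fun σ => (∀ x, vert (σ x) = vert x) ∧ ∀ x ∉ S, σ x = x)

lemma mem_vertexPerms {vert : X → Q0} {S : Finset X} {σ : Equiv.Perm X} :
    σ ∈ vertexPerms vert S ↔ σ ∈ vertexStabilizer vert S := by
  simp [vertexPerms, mem_vertexStabilizer]

lemma Jsym_eq (vert : X → Q0) (S : Finset X) (f : FF (X ⊕ Q1)) :
    Jsym vert S f = ∑ σ ∈ vertexPerms vert S, sgn Q1 σ * act (permExt Q1 σ) f := by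
  refine Finset.sum_congr rfl fun σ _ => ?_
  rcases Int.units_eq_one_or (Equiv.Perm.sign σ) with h | h <;> simp [h, sgn]

lemma Jsym_add (vert : X → Q0) (S : Finset X) (f g : FF (X ⊕ Q1)) :
    Jsym vert S (f + g) = Jsym vert S f + Jsym vert S g := by
  simp [Jsym_eq, Finset.sum_add_distrib, mul_add]

lemma Jsym_neg (vert : X → Q0) (S : Finset X) (f : FF (X ⊕ Q1)) :
    Jsym vert S (-f) = -Jsym vert S f := by
  simp [Jsym_eq]

lemma Jsym_zero (vert : X → Q0) (S : Finset X) :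
    Jsym vert S (0 : FF (X ⊕ Q1)) = 0 := by
  simp [Jsym_eq]

lemma Jsym_sum {ι : Type*} (vert : X → Q0) (S : Finset X) (s : Finset ι)
    (f : ι → FF (X ⊕ Q1)) :
    Jsym vert S (∑ i ∈ s, f i) = ∑ i ∈ s, Jsym vert S (f i) :=
  map_sum (AddMonoidHom.mk' (Jsym vert S) (Jsym_add vert S)) f s

lemma Jsym_mul_of_symmOn (vert : X → Q0) (S : Finset X) {g : FF (X ⊕ Q1)}
    (hg : SymmOn Q1 vert S g) (f : FF (X ⊕ Q1)) :
    Jsym vert S (g * f) = g * Jsym vert S f := by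
  rw [Jsym_eq, Jsym_eq, Finset.mul_sum]
  refine Finset.sum_congr rfl fun σ hσ => ?_
  obtain ⟨h1, h2⟩ := mem_vertexPerms.mp hσ
  rw [map_mul, hg σ h1 h2, mul_left_comm]

lemma act_Jsym (vert : X → Q0) (S : Finset X) {σ : Equiv.Perm X}
    (hσ : σ ∈ vertexStabilizer vert S) (f : FF (X ⊕ Q1)) :
    act (permExt Q1 σ) (Jsym vert S f) = sgn Q1 σ * Jsym vert S f := by
  rw [Jsym_eq, map_sum, Finset.mul_sum]
  refine Finset.sum_equiv (Equiv.mulLeft σ) (fun τ => ?_) (fun τ _ => ?_)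
  · simp only [mem_vertexPerms, Equiv.coe_mulLeft]
    exact ((vertexStabilizer vert S).mul_mem_cancel_left hσ).symm
  · rw [map_mul, act_sgn, act_permExt_mul, Equiv.coe_mulLeft, sgn_mul, ← mul_assoc,
      ← mul_assoc, sgn_mul_self, one_mul]

lemma Jsym_act (vert : X → Q0) (S : Finset X) {σ : Equiv.Perm X}
    (hσ : σ ∈ vertexStabilizer vert S) (f : FF (X ⊕ Q1)) :
    Jsym vert S (act (permExt Q1 σ) f) = sgn Q1 σ * Jsym vert S f := by
  rw [Jsym_eq, Jsym_eq, Finset.mul_sum]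
  refine Finset.sum_equiv (Equiv.mulRight σ) (fun τ => ?_) (fun τ _ => ?_)
  · simp only [mem_vertexPerms, Equiv.coe_mulRight]
    exact ((vertexStabilizer vert S).mul_mem_cancel_right hσ).symm
  · rw [act_permExt_mul, Equiv.coe_mulRight, sgn_mul, mul_comm (sgn Q1 τ) (sgn Q1 σ),
      ← mul_assoc, ← mul_assoc, sgn_mul_self, one_mul]

lemma act_Jsym_of_commute (vert : X → Q0) (S : Finset X) {σ : Equiv.Perm X}
    (hσ : ∀ τ ∈ vertexStabilizer vert S, Commute σ τ) (f : FF (X ⊕ Q1)) :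
    act (permExt Q1 σ) (Jsym vert S f) = Jsym vert S (act (permExt Q1 σ) f) := by
  rw [Jsym_eq, Jsym_eq, map_sum]
  refine Finset.sum_congr rfl fun τ hτ => ?_
  rw [map_mul, act_sgn, act_permExt_mul, act_permExt_mul, (hσ τ (mem_vertexPerms.mp hτ)).eq]

section Demazure

variable (vert : X → Q0) (lt : X → X → Prop) [DecidableRel lt] (S : Finset X)

lemma act_Dem {σ : Equiv.Perm X} (hσ : σ ∈ vertexStabilizer vert S) (f : FF (X ⊕ Q1)) :
    act (permExt Q1 σ) (Dem vert lt S f) = Dem vert lt S f := by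
  rw [Dem, map_mul, map_inv₀, act_Jsym vert S hσ, act_Jsym vert S hσ]
  rw [mul_inv, inv_sgn, mul_mul_mul_comm, sgn_mul_self, one_mul]

lemma rhoS_of_notMem {x : X} (hx : x ∉ S) : rhoS vert lt S x = 0 := by
  simp [rhoS, hx]

lemma act_Dem_of_disjoint {T : Finset X} (hST : Disjoint T S) {σ : Equiv.Perm X}
    (hσ : σ ∈ vertexStabilizer vert T) {f : FF (X ⊕ Q1)}
    (hf : act (permExt Q1 σ) f = f) :
    act (permExt Q1 σ) (Dem vert lt S f) = Dem vert lt S f := by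
  have hρ : act (permExt Q1 σ) (xmon Q1 (rhoS vert lt S)) = xmon Q1 (rhoS vert lt S) := by
    refine act_xmon_of_invariant fun x => ?_
    by_cases hx : x ∈ T
    · rw [rhoS_of_notMem _ _ _ (Finset.disjoint_left.mp hST hx), rhoS_of_notMem]
      exact Finset.disjoint_left.mp hST ((apply_mem_of_mem_vertexStabilizer hσ).mpr hx)
    · rw [hσ.2 x hx]
  have hc : ∀ τ ∈ vertexStabilizer vert S, Commute σ τ :=
    fun τ hτ => commute_of_disjoint hST hσ hτ
  rw [Dem, map_mul, map_inv₀, act_Jsym_of_commute vert S hc, act_Jsym_of_commute vert S hc,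
    map_mul, hρ, hf]

/-- The number of variables of `S` at the vertex of `x` coming after `x`. -/
def rhoNat (x : X) : ℕ := (S.filter (fun y => vert y = vert x ∧ lt x y)).card

lemma rhoS_of_mem {x : X} (hx : x ∈ S) : rhoS vert lt S x = rhoNat vert lt S x := by
  simp [rhoS, rhoNat, hx]

lemma rhoNat_lt_of_lt [IsStrictTotalOrder X lt] {x y : X} (hy : y ∈ S)
    (hv : vert x = vert y) (hxy : lt x y) : rhoNat vert lt S y < rhoNat vert lt S x := by
  apply Finset.card_lt_card
  rw [Finset.ssubset_iff_of_subset]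
  · refine ⟨y, by simp [hy, hv, hxy], ?_⟩
    simp [irrefl_of lt y]
  · intro z
    simp only [Finset.mem_filter]
    rintro ⟨h1, h2, h3⟩
    exact ⟨h1, h2.trans hv.symm, trans_of lt hxy h3⟩

lemma rhoNat_injOn [IsStrictTotalOrder X lt] (i : Q0) :
    Set.InjOn (rhoNat vert lt S) (S.filter (fun x => vert x = i)) := by
  intro x hx y hy h
  simp only [Finset.coe_filter, Set.mem_ofPred_eq] at hx hy
  have hv : vert x = vert y := hx.2.trans hy.2.symm
  rcases trichotomous_of lt x y with hlt | heq | hlt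
  · exact absurd h (rhoNat_lt_of_lt vert lt S hy.1 hv hlt).ne'
  · exact heq
  · exact absurd h (rhoNat_lt_of_lt vert lt S hx.1 hv.symm hlt).ne

lemma rhoNat_lt_card [IsStrictTotalOrder X lt] {x : X} (hx : x ∈ S) :
    rhoNat vert lt S x < (S.filter (fun y => vert y = vert x)).card := by
  apply Finset.card_lt_card
  rw [Finset.ssubset_iff_of_subset]
  · exact ⟨x, by simp [hx], by simp [irrefl_of lt x]⟩
  · intro z
    simp only [Finset.mem_filter]
    exact fun h => ⟨h.1, h.2.1⟩

lemma image_rhoNat [IsStrictTotalOrder X lt] (i : Q0) :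
    (S.filter (fun x => vert x = i)).image (rhoNat vert lt S)
      = Finset.range (S.filter (fun x => vert x = i)).card := by
  apply Finset.eq_of_subset_of_card_le
  · intro n hn
    obtain ⟨x, hx, rfl⟩ := Finset.mem_image.mp hn
    obtain ⟨hxS, rfl⟩ := Finset.mem_filter.mp hx
    exact Finset.mem_range.mpr (rhoNat_lt_card vert lt S hxS)
  · rw [Finset.card_image_of_injOn (rhoNat_injOn vert lt S i), Finset.card_range]

/-- The generalized alternant matrix whose determinant is `Jsym vert S (x ^ β)`. -/
def alternant (Q1 : Type) (β : X → ℤ) : Matrix X X (FF (X ⊕ Q1)) := fun x y =>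
  if vert x = vert y ∧ (y ∉ S → x = y) then xx Q1 x ^ β y else 0

lemma Jsym_xmon (β : X → ℤ) :
    Jsym vert S (xmon Q1 β) = (alternant vert S Q1 β).det := by
  rw [Matrix.det_apply', Jsym_eq, vertexPerms, Finset.sum_filter]
  refine Finset.sum_congr rfl fun σ _ => ?_
  split_ifs with h
  · rw [act_xmon]
    congr 1
    refine Finset.prod_congr rfl fun x _ => ?_
    rw [alternant, if_pos ⟨h.1 x, h.2 x⟩]
  · have : ∃ x, ¬ (vert (σ x) = vert x ∧ (x ∉ S → σ x = x)) := by
      by_contra! hc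
      exact h ⟨fun x => (hc x).1, fun x => (hc x).2⟩
    obtain ⟨x, hx⟩ := this
    rw [Finset.prod_eq_zero (Finset.mem_univ x), mul_zero]
    rw [alternant, if_neg hx]

lemma Jsym_xmon_rhoS_ne_zero [IsStrictTotalOrder X lt] :
    Jsym vert S (xmon Q1 (rhoS vert lt S)) ≠ 0 := by
  rw [Jsym_xmon]
  intro hdet
  obtain ⟨v, hv, hMv⟩ := Matrix.exists_mulVec_eq_zero_iff.mpr hdet
  have hrow : ∀ x, ∑ y, (alternant vert S Q1 (rhoS vert lt S)) x y * v y = 0 :=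
    fun x => congrFun hMv x
  have hin : ∀ y ∈ S, v y = 0 := by
    intro y₀ hy₀
    set F := S.filter (fun x => vert x = vert y₀) with hF
    let p : Polynomial (FF (X ⊕ Q1)) :=
      ∑ y ∈ F, Polynomial.monomial (rhoNat vert lt S y) (v y)
    have hdeg : p.degree < F.card := by
      refine (Polynomial.degree_sum_le _ _).trans_lt ?_
      rw [Finset.sup_lt_iff (WithBot.bot_lt_coe _)]
      intro y hy
      refine (Polynomial.degree_monomial_le _ _).trans_lt ?_
      obtain ⟨hyS, hyv⟩ := Finset.mem_filter.mp hy
      have := rhoNat_lt_card vert lt S hyS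
      rw [hyv] at this
      exact_mod_cast this
    have hroot : ∀ x ∈ F, p.eval (xx Q1 x) = 0 := by
      intro x hx
      obtain ⟨hxS, hxv⟩ := Finset.mem_filter.mp hx
      rw [← hrow x, Polynomial.eval_finsetSum, hF, Finset.sum_filter,
        ← Finset.sum_subset (Finset.subset_univ S)]
      · refine Finset.sum_congr rfl fun y hy => ?_
        rw [alternant, hxv]
        simp only [hy, not_true_eq_false, false_imp_iff, and_true, eq_comm (a := vert y₀)]
        split_ifs
        · rw [Polynomial.eval_monomial, rhoS_of_mem vert lt S hy, zpow_natCast, mul_comm]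
        · rw [zero_mul]
      · intro y _ hy
        rw [alternant, if_neg, zero_mul]
        rintro ⟨-, h⟩
        exact hy (h hy ▸ hxS)
    have hp : p = 0 := by
      classical
      refine Polynomial.eq_zero_of_degree_lt_of_eval_finset_eq_zero
        (F.image (xx Q1)) ?_ ?_
      · rwa [Finset.card_image_of_injective _ xx_injective]
      · intro z hz
        obtain ⟨x, hx, rfl⟩ := Finset.mem_image.mp hz
        exact hroot x hx
    have hy₀F : y₀ ∈ F := by simp [hF, hy₀]
    have hcoeff := congrArg (fun q => q.coeff (rhoNat vert lt S y₀)) hp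
    simp only [p, Polynomial.finsetSum_coeff, Polynomial.coeff_monomial,
      Polynomial.coeff_zero] at hcoeff
    rw [Finset.sum_eq_single y₀] at hcoeff
    · simpa using hcoeff
    · intro y hy hne
      rw [if_neg]
      exact fun h => hne (rhoNat_injOn vert lt S (vert y₀) hy hy₀F h)
    · exact fun h => absurd hy₀F h
  apply hv
  funext x
  by_cases hx : x ∈ S
  · exact hin x hx
  · have := hrow x
    rw [Finset.sum_eq_single x] at this
    · simpa [alternant, rhoS_of_notMem vert lt S hx] using this
    · intro y _ hy
      by_cases hyS : y ∈ S
      · rw [hin y hyS, mul_zero]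
      · rw [alternant, if_neg, zero_mul]
        exact fun h => hy (h.2 hyS).symm
    · simp

/-- Symmetrizing first over a subset of the variables does not change the Demazure
symmetrizer, provided the staircases differ by a symmetric exponent. -/
lemma Dem_Dem_mul [IsStrictTotalOrder X lt] {T : Finset X} (hST : S ⊆ T)
    (hρ : ∀ x ∈ S, ∀ y ∈ S, vert x = vert y →
      rhoS vert lt T x - rhoS vert lt S x = rhoS vert lt T y - rhoS vert lt S y)
    (f g : FF (X ⊕ Q1)) (hg : SymmOn Q1 vert S g) :
    Dem vert lt T (Dem vert lt S f * g) = Dem vert lt T (f * g) := by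
  rw [Dem, Dem]
  congr 1
  set e := Jsym vert S (xmon Q1 (rhoS vert lt S)) with he
  have he0 : e ≠ 0 := Jsym_xmon_rhoS_ne_zero vert lt S
  set P := xmon Q1 (rhoS vert lt T - rhoS vert lt S) * g with hP
  have hsplit : xmon Q1 (rhoS vert lt T)
      = xmon Q1 (rhoS vert lt T - rhoS vert lt S) * xmon Q1 (rhoS vert lt S) := by
    rw [← xmon_add, sub_add_cancel]
  have hPinv : SymmOn Q1 vert S P := by
    intro σ h1 h2
    have hσ : σ ∈ vertexStabilizer vert S := ⟨h1, h2⟩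
    rw [hP, map_mul, hg σ h1 h2, act_xmon_of_invariant]
    intro x
    by_cases hx : x ∈ S
    · exact hρ _ ((apply_mem_of_mem_vertexStabilizer hσ).mpr hx) _ hx (h1 x)
    · rw [h2 x hx]
  set r := xmon Q1 (rhoS vert lt S) with hr
  have hterm : ∀ σ ∈ vertexPerms vert S,
      Jsym vert T (P * r * e⁻¹ * (sgn Q1 σ * act (permExt Q1 σ) (r * f)))
        = Jsym vert T (P * e⁻¹ * (r * f) * (sgn Q1 σ⁻¹ * act (permExt Q1 σ⁻¹) r)) := by
    intro σ hσ
    rw [mem_vertexPerms] at hσ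
    have hid : act (permExt Q1 σ) (act (permExt Q1 σ⁻¹) r) = r := by
      rw [act_permExt_mul, mul_inv_cancel, hr, act_xmon]
      rfl
    have key : act (permExt Q1 σ) (P * e⁻¹ * (r * f) * (sgn Q1 σ⁻¹ * act (permExt Q1 σ⁻¹) r))
        = sgn Q1 σ * (P * r * e⁻¹ * (sgn Q1 σ * act (permExt Q1 σ) (r * f))) := by
      rw [map_mul, map_mul _ (sgn Q1 σ⁻¹), hid, map_mul, map_mul _ P, hPinv σ hσ.1 hσ.2,
        map_inv₀, he, act_Jsym vert S hσ, mul_inv, inv_sgn, act_sgn, sgn_inv]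
      ring
    have h := Jsym_act vert T (vertexStabilizer_mono hST hσ)
      (P * e⁻¹ * (r * f) * (sgn Q1 σ⁻¹ * act (permExt Q1 σ⁻¹) r))
    have hsgn : SymmOn Q1 vert T (sgn Q1 σ) := fun τ _ _ => act_sgn τ σ
    rw [key, Jsym_mul_of_symmOn vert T hsgn] at h
    exact mul_left_cancel₀ (sgn_ne_zero σ) h
  have hsum : ∑ σ ∈ vertexPerms vert S, sgn Q1 σ⁻¹ * act (permExt Q1 σ⁻¹) r = e := by
    rw [he, Jsym_eq]
    refine Finset.sum_equiv (Equiv.inv _) (fun σ => ?_) (fun σ _ => rfl)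
    simp [mem_vertexPerms]
  calc Jsym vert T (xmon Q1 (rhoS vert lt T) * (Dem vert lt S f * g))
      = Jsym vert T (∑ σ ∈ vertexPerms vert S,
          P * r * e⁻¹ * (sgn Q1 σ * act (permExt Q1 σ) (r * f))) := by
        rw [← Finset.mul_sum, ← Jsym_eq, hsplit, Dem, hP]
        congr 1
        ring
    _ = Jsym vert T (∑ σ ∈ vertexPerms vert S,
          P * e⁻¹ * (r * f) * (sgn Q1 σ⁻¹ * act (permExt Q1 σ⁻¹) r)) := by
        rw [Jsym_sum, Jsym_sum]
        exact Finset.sum_congr rfl hterm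
    _ = Jsym vert T (xmon Q1 (rhoS vert lt T) * (f * g)) := by
        rw [← Finset.mul_sum, hsum, hsplit, hP]
        congr 1
        field_simp

end Demazure

end

end Shuffle
namespace Shuffle

noncomputable section

set_option linter.unusedSectionVars false

section Laurent

variable {X Q0 Q1 : Type} [Fintype X] [DecidableEq X] [DecidableEq Q0] [Fintype Q1]

lemma xx_mem {S : Finset X} {x : X} (hx : x ∈ S) : xx Q1 x ∈ LaurentIn Q1 S :=
  Subring.subset_closure (Or.inl (Or.inl (Or.inl ⟨x, hx, rfl⟩)))

lemma xx_inv_mem {S : Finset X} {x : X} (hx : x ∈ S) : (xx Q1 x)⁻¹ ∈ LaurentIn Q1 S :=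
  Subring.subset_closure (Or.inl (Or.inl (Or.inr ⟨x, hx, rfl⟩)))

lemma tt_mem (S : Finset X) (b : Q1) : tt X b ∈ LaurentIn Q1 S :=
  Subring.subset_closure (Or.inl (Or.inr ⟨b, rfl⟩))

lemma xx_zpow_mem {S : Finset X} {x : X} (hx : x ∈ S) (n : ℤ) :
    xx Q1 x ^ n ∈ LaurentIn Q1 S := by
  cases n with
  | ofNat n => simpa using pow_mem (xx_mem hx) n
  | negSucc n => simpa [zpow_negSucc, ← inv_pow] using pow_mem (xx_inv_mem hx) (n + 1)

lemma xmon_mem (β : X → ℤ) : xmon Q1 β ∈ LaurentIn Q1 (Finset.univ : Finset X) :=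
  prod_mem fun x _ => xx_zpow_mem (Finset.mem_univ x) (β x)

lemma one_sub_mem (b : Q1) (x y : X) :
    1 - tt X b * xx Q1 x / xx Q1 y ∈ LaurentIn Q1 (Finset.univ : Finset X) := by
  rw [div_eq_mul_inv]
  exact sub_mem (one_mem _) (mul_mem (mul_mem (tt_mem _ b) (xx_mem (Finset.mem_univ x)))
    (xx_inv_mem (Finset.mem_univ y)))

/-- Integer powers of the variables at a vertex are given by a common polynomial with
Laurent polynomial coefficients. -/
lemma exists_aeval_eq_zpow (vert : X → Q0) (i : Q0) (n : ℤ) :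
    ∃ p : Polynomial (LaurentIn Q1 (Finset.univ : Finset X)),
      (p.degree < ((Finset.univ.filter (fun x => vert x = i)).card : WithBot ℕ)) ∧
      ∀ x, vert x = i → Polynomial.aeval (xx Q1 x) p = xx Q1 x ^ n := by
  set L := LaurentIn Q1 (Finset.univ : Finset X) with hL
  set F := Finset.univ.filter (fun x => vert x = i) with hF
  let c : X → L := fun x => ⟨xx Q1 x, xx_mem (Finset.mem_univ x)⟩
  let P : Polynomial L := ∏ x ∈ F, (Polynomial.X - Polynomial.C (c x))
  have hPm : P.Monic := Polynomial.monic_prod_X_sub_C c F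
  have hPdeg : P.degree = F.card := by
    rw [Polynomial.degree_eq_natDegree hPm.ne_zero,
      Polynomial.natDegree_finsetProd_X_sub_C_eq_card]
  have hroot : ∀ x, vert x = i → Polynomial.aeval (xx Q1 x) P = 0 := by
    intro x hx
    simp only [P, map_prod]
    refine Finset.prod_eq_zero (i := x) (by simp [hF, hx]) ?_
    rw [map_sub, Polynomial.aeval_X, Polynomial.aeval_C]
    exact sub_self _
  suffices h : ∃ q : Polynomial L, ∀ x, vert x = i →
      Polynomial.aeval (xx Q1 x) q = xx Q1 x ^ n by
    obtain ⟨q, hq⟩ := h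
    refine ⟨q %ₘ P, ?_, fun x hx => ?_⟩
    · rw [← hPdeg]
      exact Polynomial.degree_modByMonic_lt q hPm
    · rw [Polynomial.aeval_modByMonic_eq_self_of_root (hroot x hx), hq x hx]
  cases n with
  | ofNat n => exact ⟨Polynomial.X ^ n, fun x _ => by simp⟩
  | negSucc n =>
    let d : X → L := fun x => ⟨(xx Q1 x)⁻¹, xx_inv_mem (Finset.mem_univ x)⟩
    have hcd : ∀ x, c x * d x = 1 := fun x => Subtype.ext (mul_inv_cancel₀ (xx_ne_zero x))
    let u : L := ∏ x ∈ F, -d x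
    have hu : P.coeff 0 * u = 1 := by
      rw [Polynomial.coeff_zero_eq_eval_zero, Polynomial.eval_prod, ← Finset.prod_mul_distrib]
      refine Finset.prod_eq_one fun x _ => ?_
      simp [hcd]
    refine ⟨(-(Polynomial.C u * P.divX)) ^ (n + 1), fun x hx => ?_⟩
    have h := congrArg (Polynomial.aeval (xx Q1 x)) P.divX_mul_X_add
    rw [hroot x hx, map_add, map_mul, Polynomial.aeval_X, Polynomial.aeval_C] at h
    have hu' : algebraMap L (FF (X ⊕ Q1)) (P.coeff 0) * algebraMap L (FF (X ⊕ Q1)) u = 1 := by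
      rw [← map_mul, hu, map_one]
    rw [zpow_negSucc, ← inv_pow, map_pow, map_neg, map_mul, Polynomial.aeval_C]
    congr 1
    apply eq_inv_of_mul_eq_one_left
    linear_combination -(algebraMap L (FF (X ⊕ Q1)) u) * h + hu'

variable (vert : X → Q0) (lt : X → X → Prop) [DecidableRel lt] [IsStrictTotalOrder X lt]

lemma exists_Jsym_xmon_eq_mul (β : X → ℤ) :
    ∃ c ∈ LaurentIn Q1 (Finset.univ : Finset X), Jsym vert Finset.univ (xmon Q1 β)
      = Jsym vert Finset.univ (xmon Q1 (rhoS vert lt Finset.univ)) * c := by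
  choose p hdeg hp using fun y => exists_aeval_eq_zpow (Q1 := Q1) vert (vert y) (β y)
  let N : Matrix X X (LaurentIn Q1 (Finset.univ : Finset X)) := fun z y =>
    if vert z = vert y then (p y).coeff (rhoNat vert lt Finset.univ z) else 0
  refine ⟨(N.det : FF (X ⊕ Q1)), N.det.2, ?_⟩
  have hdet : (N.det : FF (X ⊕ Q1))
      = ((LaurentIn Q1 (Finset.univ : Finset X)).subtype.mapMatrix N).det :=
    RingHom.map_det (LaurentIn Q1 (Finset.univ : Finset X)).subtype N
  have hN : ∀ z y, (LaurentIn Q1 (Finset.univ : Finset X)).subtype.mapMatrix N z y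
      = if vert z = vert y
        then ((p y).coeff (rhoNat vert lt Finset.univ z) : FF (X ⊕ Q1)) else 0 := by
    intro z y
    change ((if vert z = vert y then (p y).coeff (rhoNat vert lt Finset.univ z) else 0 :
      LaurentIn Q1 (Finset.univ : Finset X)) : FF (X ⊕ Q1)) = _
    split_ifs <;> rfl
  rw [Jsym_xmon, Jsym_xmon, hdet, ← Matrix.det_mul]
  congr 1
  ext x y
  simp only [Matrix.mul_apply, hN]
  by_cases hxy : vert x = vert y
  · rw [alternant, if_pos ⟨hxy, by simp⟩, ← hp y x hxy]
    have hlt : (p y).natDegree < (Finset.univ.filter (fun z => vert z = vert y)).card := by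
      by_cases h0 : p y = 0
      · rw [h0, Polynomial.natDegree_zero]
        exact Finset.card_pos.mpr ⟨x, by simp [hxy]⟩
      · exact (Polynomial.natDegree_lt_iff_degree_lt h0).mpr (hdeg y)
    rw [Polynomial.aeval_eq_sum_range' hlt, ← image_rhoNat vert lt Finset.univ (vert y),
      Finset.sum_image (rhoNat_injOn vert lt _ _), Finset.sum_filter]
    refine Finset.sum_congr rfl fun z _ => ?_
    by_cases hz : vert z = vert y
    · rw [if_pos hz, if_pos hz, alternant, if_pos ⟨hxy.trans hz.symm, by simp⟩,
        rhoS_of_mem _ _ _ (Finset.mem_univ z), zpow_natCast, mul_comm]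
      rfl
    · rw [if_neg hz, if_neg hz, mul_zero]
  · rw [alternant, if_neg fun h => hxy h.1, Finset.sum_eq_zero]
    intro z _
    by_cases hz : vert z = vert y
    · rw [alternant, if_neg, zero_mul]
      exact fun h => hxy (h.1.trans hz)
    · rw [if_neg hz, mul_zero]

/-- A product of variables and their inverses is a monomial in the `x`-variables times a
monomial in the arrow variables. -/
lemma exists_eq_mul_xmon_of_mem_closure {f : FF (X ⊕ Q1)}
    (hf : f ∈ Submonoid.closure
      ((fun x : X => xx Q1 x) '' ↑(Finset.univ : Finset X)
        ∪ (fun x : X => (xx Q1 x)⁻¹) '' ↑(Finset.univ : Finset X)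
        ∪ Set.range (tt X (Q1 := Q1)) ∪ Set.range (fun b : Q1 => (tt X b)⁻¹))) :
    ∃ c ∈ LaurentIn Q1 (Finset.univ : Finset X), ∃ β : X → ℤ,
      (∀ σ : Equiv.Perm X, act (permExt Q1 σ) c = c) ∧ f = c * xmon Q1 β := by
  have hx0 : xmon Q1 (0 : X → ℤ) = 1 := by simp [xmon]
  have hsingle : ∀ (x : X) (n : ℤ), xmon Q1 (Pi.single x n) = xx Q1 x ^ n := by
    intro x n
    rw [xmon, Finset.prod_eq_single x]
    · simp
    · intro y _ hy
      simp [Pi.single_eq_of_ne hy]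
    · simp
  induction hf using Submonoid.closure_induction with
  | mem f hf =>
    rcases hf with ((⟨x, -, rfl⟩ | ⟨x, -, rfl⟩) | ⟨b, rfl⟩) | ⟨b, rfl⟩
    · exact ⟨1, one_mem _, Pi.single x 1, by simp, by simp [hsingle]⟩
    · exact ⟨1, one_mem _, Pi.single x (-1), by simp, by simp [hsingle]⟩
    · exact ⟨_, tt_mem _ b, 0, by simp, by simp [hx0]⟩
    · exact ⟨_, Subring.subset_closure (Or.inr ⟨b, rfl⟩), 0, by simp, by simp [hx0]⟩
  | one => exact ⟨1, one_mem _, 0, by simp, by simp [hx0]⟩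
  | mul f g _ _ hf hg =>
    obtain ⟨c, hc, β, hcs, rfl⟩ := hf
    obtain ⟨d, hd, γ, hds, rfl⟩ := hg
    refine ⟨c * d, mul_mem hc hd, β + γ, fun σ => by rw [map_mul, hcs, hds], ?_⟩
    rw [xmon_add]
    ring

/-- The Demazure symmetrizer preserves Laurent polynomials. -/
lemma Dem_mem {f : FF (X ⊕ Q1)} (hf : f ∈ LaurentIn Q1 (Finset.univ : Finset X)) :
    Dem vert lt Finset.univ f ∈ LaurentIn Q1 (Finset.univ : Finset X) := by
  rw [LaurentIn, Subring.mem_closure_iff] at hf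
  induction hf using AddSubgroup.closure_induction with
  | mem f hf =>
    obtain ⟨c, hc, β, hcs, rfl⟩ := exists_eq_mul_xmon_of_mem_closure hf
    obtain ⟨d, hd, hJ⟩ :=
      exists_Jsym_xmon_eq_mul (Q1 := Q1) vert lt (rhoS vert lt Finset.univ + β)
    have : Dem vert lt Finset.univ (c * xmon Q1 β) = c * d := by
      rw [Dem, mul_left_comm, ← xmon_add, Jsym_mul_of_symmOn _ _ (fun σ _ _ => hcs σ), hJ,
        mul_left_comm c, inv_mul_cancel_left₀ (Jsym_xmon_rhoS_ne_zero vert lt _)]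
    rw [this]
    exact mul_mem hc hd
  | zero => simp [Dem, Jsym_zero]
  | add f g _ _ hf hg =>
    rw [Dem, mul_add, Jsym_add, mul_add]
    exact add_mem hf hg
  | neg f _ hf =>
    rw [Dem, mul_neg, Jsym_neg, mul_neg]
    exact neg_mem hf

end Laurent

end

end Shuffle

namespace QHL

open QKS Shuffle

noncomputable section

set_option linter.unusedSectionVars false

variable {Q0 Q1 : Type} [DecidableEq Q0] [Fintype Q1] {m : ℕ} {a : Fin m → ℕ}

instance : IsStrictTotalOrder (Coord m a) (fun x y => coordLT x y) where
  trichotomous x y h1 h2 := by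
    obtain ⟨k, p⟩ := x
    obtain ⟨l, q⟩ := y
    simp only [coordLT, not_or, not_and, not_lt] at h1 h2
    obtain rfl : k = l := le_antisymm h2.1 h1.1
    obtain rfl : p = q := Fin.ext (le_antisymm (h2.2 rfl) (h1.2 rfl))
    rfl
  irrefl x := by simp [coordLT]
  trans x y z := by
    simp only [coordLT]
    rintro (h1 | ⟨h1, h1'⟩) (h2 | ⟨h2, h2'⟩)
    · exact Or.inl (h1.trans h2)
    · exact Or.inl (h2 ▸ h1)
    · exact Or.inl (h1 ▸ h2)
    · exact Or.inr ⟨h1.trans h2, h1'.trans h2'⟩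

/-- The contribution of the ordered pair of variables `(x, y)` to `C_{ν•} B_{𝐢,𝐚}`. -/
def pairFactor (hd tl : Q1 → Q0) (iseq : Fin m → Q0) (a : Fin m → ℕ) (x y : Coord m a) :
    FF (Coord m a ⊕ Q1) :=
  ∏ b : Q1, if tl b = iseq x.1 ∧ hd b = iseq y.1 ∧ ¬ x.1 < y.1
    then 1 - tt (Coord m a) b * xx Q1 x / xx Q1 y else 1

lemma prod_arrow_filter {X M : Type*} [CommMonoid M] (vert : X → Q0) (hd tl : Q1 → Q0)
    (S T : Finset X) (f : Q1 → X → X → M) :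
    ∏ b : Q1, ∏ y ∈ S.filter (fun y => vert y = hd b), ∏ x ∈ T.filter (fun x => vert x = tl b),
      f b x y
      = ∏ x ∈ T, ∏ y ∈ S, ∏ b : Q1, if vert x = tl b ∧ vert y = hd b then f b x y else 1 := by
  have h : ∀ b : Q1, ∏ y ∈ S.filter (fun y => vert y = hd b),
      ∏ x ∈ T.filter (fun x => vert x = tl b), f b x y
        = ∏ x ∈ T, ∏ y ∈ S, if vert x = tl b ∧ vert y = hd b then f b x y else 1 := by
    intro b
    rw [Finset.prod_comm, Finset.prod_filter]
    refine Finset.prod_congr rfl fun x _ => ?_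
    split_ifs with hx <;> simp [hx, Finset.prod_filter]
  simp only [h]
  rw [Finset.prod_comm]
  exact Finset.prod_congr rfl fun x _ => Finset.prod_comm

lemma CfieldS_mul_BfieldS (hd tl : Q1 → Q0) (iseq : Fin m → Q0) (S : Finset (Coord m a)) :
    CfieldS hd tl iseq a S * BfieldS hd tl iseq a S
      = ∏ x ∈ S, ∏ y ∈ S, pairFactor hd tl iseq a x y := by
  have hC : CfieldS hd tl iseq a S = ∏ x ∈ S, ∏ y ∈ S, ∏ b : Q1,
      if tl b = iseq x.1 ∧ hd b = iseq y.1
        then 1 - tt (Coord m a) b * xx Q1 x / xx Q1 y else 1 := by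
    rw [CfieldS, prod_arrow_filter]
    simp only [eq_comm]
  rw [hC, BfieldS]
  simp only [← Finset.prod_mul_distrib, pairFactor]
  refine Finset.prod_congr rfl fun x _ => Finset.prod_congr rfl fun y _ =>
    Finset.prod_congr rfl fun b _ => ?_
  have h0 := one_sub_ne_zero b x y
  by_cases h1 : tl b = iseq x.1 ∧ hd b = iseq y.1
  · by_cases h2 : x.1 < y.1
    · simp [h1, h2, h0]
    · simp [h1, h2]
  · rw [if_neg h1, if_neg (fun h => h1 h.2), if_neg (fun h => h1 ⟨h.1, h.2.1⟩), one_mul]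

lemma CfieldS_mul_BfieldS_mem (hd tl : Q1 → Q0) (iseq : Fin m → Q0) :
    CfieldS hd tl iseq a Finset.univ * BfieldS hd tl iseq a Finset.univ
      ∈ LaurentIn Q1 (Finset.univ : Finset (Coord m a)) := by
  rw [CfieldS_mul_BfieldS]
  refine prod_mem fun x _ => prod_mem fun y _ => prod_mem fun b _ => ?_
  split_ifs
  · exact one_sub_mem b x y
  · exact one_mem _

lemma psiF_mem (hd tl : Q1 → Q0) (iseq : Fin m → Q0) (mu : Coord m a → ℤ) :
    psiF hd tl iseq a mu Finset.univ ∈ LaurentIn Q1 (Finset.univ : Finset (Coord m a)) :=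
  Dem_mem _ _ (mul_mem (xmon_mem _) (CfieldS_mul_BfieldS_mem hd tl iseq))

lemma psiF_symmOn (hd tl : Q1 → Q0) (iseq : Fin m → Q0) (mu : Coord m a → ℤ)
    (S : Finset (Coord m a)) :
    SymmOn Q1 (fun x => iseq x.1) S (psiF hd tl iseq a mu S) :=
  fun _ h1 h2 => act_Dem _ _ _ ⟨h1, h2⟩ _

/-- The symmetrized Laurent polynomial defining `psiF`. -/
def psiIntegrand (hd tl : Q1 → Q0) (iseq : Fin m → Q0) (a : Fin m → ℕ) (mu : Coord m a → ℤ)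
    (S : Finset (Coord m a)) : FF (Coord m a ⊕ Q1) :=
  xmon Q1 (fun x => if x ∈ S then mu x else 0)
      * (CfieldS hd tl iseq a S * BfieldS hd tl iseq a S)

lemma act_psiIntegrand (hd tl : Q1 → Q0) (iseq : Fin m → Q0) (mu : Coord m a → ℤ)
    {S : Finset (Coord m a)} {σ : Equiv.Perm (Coord m a)} (hσ : ∀ x ∈ S, σ x = x) :
    act (permExt Q1 σ) (psiIntegrand hd tl iseq a mu S) = psiIntegrand hd tl iseq a mu S := by
  have hmem : ∀ x, σ x ∈ S ↔ x ∈ S := by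
    intro x
    refine ⟨fun h => ?_, fun h => by rwa [hσ x h]⟩
    rwa [σ.injective (hσ _ h)] at h
  rw [psiIntegrand, CfieldS_mul_BfieldS, map_mul, act_xmon_of_invariant]
  · congr 1
    simp only [map_prod, pairFactor]
    refine Finset.prod_congr rfl fun x hx => Finset.prod_congr rfl fun y hy =>
      Finset.prod_congr rfl fun b _ => ?_
    split_ifs <;> simp [hσ x hx, hσ y hy]
  · intro x
    by_cases hx : x ∈ S
    · rw [hσ x hx]
    · rw [if_neg hx, if_neg (by rwa [hmem])]

/-- The kernel of the shuffle product `starMul`. -/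
def starKernel {X : Type} (vert : X → Q0) (hd tl : Q1 → Q0) (A B : Finset X) : FF (X ⊕ Q1) :=
  ∏ b : Q1, ∏ y ∈ B.filter (fun y => vert y = tl b), ∏ x ∈ A.filter (fun x => vert x = hd b),
    (1 - tt X b * xx Q1 y / xx Q1 x)

lemma act_starKernel {X : Type} (vert : X → Q0) (hd tl : Q1 → Q0) {A B : Finset X}
    {σ : Equiv.Perm X} (hv : ∀ x, vert (σ x) = vert x) (hA : ∀ x, σ x ∈ A ↔ x ∈ A)
    (hB : ∀ x, σ x ∈ B ↔ x ∈ B) :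
    act (permExt Q1 σ) (starKernel vert hd tl A B) = starKernel vert hd tl A B := by
  simp only [starKernel, map_prod]
  refine Finset.prod_congr rfl fun b _ => ?_
  refine Finset.prod_equiv σ (fun y => by simp [hv, hB]) fun y _ => ?_
  refine Finset.prod_equiv σ (fun x => by simp [hv, hA]) fun x _ => ?_
  simp

lemma disjoint_headF_tailF (k : ℕ) : Disjoint (headF m a k) (tailF m a k) := by
  rw [Finset.disjoint_left]
  intro x
  simp [headF, tailF]

lemma headF_union_tailF (k : ℕ) : headF m a k ∪ tailF m a k = Finset.univ := by
  ext x
  simp [headF, tailF, lt_or_ge]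

lemma lt_of_mem_headF_of_mem_tailF {k : ℕ} {x y : Coord m a} (hx : x ∈ headF m a k)
    (hy : y ∈ tailF m a k) : x.1 < y.1 := by
  simp only [headF, tailF, Finset.mem_filter, Finset.mem_univ, true_and] at hx hy
  exact Fin.lt_def.mpr (hx.trans_le hy)

lemma starKernel_eq_prod_pairFactor (hd tl : Q1 → Q0) (iseq : Fin m → Q0) (k : ℕ) :
    starKernel (fun x => iseq x.1) hd tl (headF m a k) (tailF m a k)
      = ∏ x ∈ tailF m a k, ∏ y ∈ headF m a k, pairFactor hd tl iseq a x y := by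
  have hcomm : starKernel (fun x => iseq x.1) hd tl (headF m a k) (tailF m a k)
      = ∏ b : Q1, ∏ y ∈ (headF m a k).filter (fun y => iseq y.1 = hd b),
        ∏ x ∈ (tailF m a k).filter (fun x => iseq x.1 = tl b),
          (1 - tt (Coord m a) b * xx Q1 x / xx Q1 y) :=
    Finset.prod_congr rfl fun b _ => Finset.prod_comm
  rw [hcomm, prod_arrow_filter (fun x : Coord m a => iseq x.1)]
  refine Finset.prod_congr rfl fun x hx => Finset.prod_congr rfl fun y hy =>
    Finset.prod_congr rfl fun b _ => ?_
  have hlt : ¬ x.1 < y.1 := (lt_of_mem_headF_of_mem_tailF hy hx).not_gt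
  simp only [hlt, not_false_eq_true, and_true, eq_comm]

lemma psiIntegrand_univ (hd tl : Q1 → Q0) (iseq : Fin m → Q0) (mu : Coord m a → ℤ) (k : ℕ) :
    psiIntegrand hd tl iseq a mu Finset.univ
      = psiIntegrand hd tl iseq a mu (headF m a k) * (psiIntegrand hd tl iseq a mu (tailF m a k)
        * starKernel (fun x => iseq x.1) hd tl (headF m a k) (tailF m a k)) := by
  have hdisj := disjoint_headF_tailF (a := a) k
  have hmu : (fun x => if x ∈ (Finset.univ : Finset (Coord m a)) then mu x else 0)
      = (fun x => if x ∈ headF m a k then mu x else 0)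
        + (fun x => if x ∈ tailF m a k then mu x else 0) := by
    funext x
    by_cases hx : (x.1 : ℕ) < k
    · simp [headF, tailF, hx, not_le.mpr hx]
    · simp [headF, tailF, hx, not_lt.mp hx]
  have hone : ∏ x ∈ headF m a k, ∏ y ∈ tailF m a k, pairFactor hd tl iseq a x y = 1 := by
    refine Finset.prod_eq_one fun x hx => Finset.prod_eq_one fun y hy =>
      Finset.prod_eq_one fun b _ => ?_
    rw [if_neg]
    exact fun h => h.2.2 (lt_of_mem_headF_of_mem_tailF hx hy)
  simp only [psiIntegrand, CfieldS_mul_BfieldS]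
  rw [hmu, xmon_add, starKernel_eq_prod_pairFactor, ← headF_union_tailF (a := a) k]
  simp only [Finset.prod_union hdisj, Finset.prod_mul_distrib, hone]
  ring

lemma rhoS_univ_of_mem_headF (iseq : Fin m → Q0) {k : ℕ} {x : Coord m a}
    (hx : x ∈ headF m a k) :
    rhoS (fun x => iseq x.1) (fun x y => coordLT x y) Finset.univ x
      - rhoS (fun x => iseq x.1) (fun x y => coordLT x y) (headF m a k) x
      = ((tailF m a k).filter (fun y => iseq y.1 = iseq x.1)).card := by
  rw [rhoS, rhoS, if_pos (Finset.mem_univ x), if_pos hx, ← headF_union_tailF (a := a) k,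
    Finset.filter_union, Finset.card_union_of_disjoint
      (Finset.disjoint_filter_filter (disjoint_headF_tailF k)), Nat.cast_add,
    add_sub_cancel_left]
  congr 2
  refine Finset.filter_congr fun y hy => ?_
  exact and_iff_left (Or.inl (lt_of_mem_headF_of_mem_tailF hx hy))

lemma rhoS_univ_of_mem_tailF (iseq : Fin m → Q0) {k : ℕ} {x : Coord m a}
    (hx : x ∈ tailF m a k) :
    rhoS (fun x => iseq x.1) (fun x y => coordLT x y) Finset.univ x
      - rhoS (fun x => iseq x.1) (fun x y => coordLT x y) (tailF m a k) x = 0 := by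
  rw [rhoS, rhoS, if_pos (Finset.mem_univ x), if_pos hx, ← headF_union_tailF (a := a) k,
    Finset.filter_union, Finset.filter_false_of_mem (s := headF m a k), Finset.empty_union,
    sub_self]
  rintro y hy ⟨-, hlt⟩
  have h := lt_of_mem_headF_of_mem_tailF hy hx
  rcases hlt with hlt | ⟨heq, -⟩
  · exact h.not_gt hlt
  · exact h.ne' heq

lemma psiF_univ (hd tl : Q1 → Q0) (iseq : Fin m → Q0) (mu : Coord m a → ℤ) (k : ℕ) :
    psiF hd tl iseq a mu Finset.univ
      = starMul (fun x => iseq x.1) hd tl (fun x y => coordLT x y) (headF m a k) (tailF m a k)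
          (psiF hd tl iseq a mu (headF m a k)) (psiF hd tl iseq a mu (tailF m a k)) := by
  have hdisj := disjoint_headF_tailF (a := a) k
  set A := headF m a k with hA
  set B := tailF m a k with hB
  set K : FF (Coord m a ⊕ Q1) := starKernel (fun x => iseq x.1) hd tl A B with hK
  have hKA : SymmOn Q1 (fun x => iseq x.1) A K := by
    intro σ h1 h2
    have hσ : σ ∈ vertexStabilizer (fun x : Coord m a => iseq x.1) A := ⟨h1, h2⟩
    refine act_starKernel _ _ _ h1
      (fun x => apply_mem_of_mem_vertexStabilizer hσ) fun x => ?_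
    by_cases hx : x ∈ A
    · have hσx : σ x ∈ A := (apply_mem_of_mem_vertexStabilizer hσ).mpr hx
      exact iff_of_false (Finset.disjoint_left.mp hdisj hσx) (Finset.disjoint_left.mp hdisj hx)
    · rw [h2 x hx]
  have hKB : SymmOn Q1 (fun x => iseq x.1) B K := by
    intro σ h1 h2
    have hσ : σ ∈ vertexStabilizer (fun x : Coord m a => iseq x.1) B := ⟨h1, h2⟩
    refine act_starKernel _ _ _ h1 (fun x => ?_)
      (fun x => apply_mem_of_mem_vertexStabilizer hσ)
    by_cases hx : x ∈ B
    · have hσx : σ x ∈ B := (apply_mem_of_mem_vertexStabilizer hσ).mpr hx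
      exact iff_of_false (Finset.disjoint_right.mp hdisj hσx) (Finset.disjoint_right.mp hdisj hx)
    · rw [h2 x hx]
  change Dem _ _ Finset.univ (psiIntegrand hd tl iseq a mu Finset.univ)
    = Dem _ _ (A ∪ B) (psiF hd tl iseq a mu A * psiF hd tl iseq a mu B * K)
  rw [headF_union_tailF, psiIntegrand_univ hd tl iseq mu k,
    ← Dem_Dem_mul _ _ A (Finset.subset_univ A), mul_left_comm,
    ← Dem_Dem_mul _ _ B (Finset.subset_univ B)]
  · congr 1
    change psiF hd tl iseq a mu B * (psiF hd tl iseq a mu A * K) = _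
    ring
  · intro x hx y hy _
    rw [rhoS_univ_of_mem_tailF iseq hx, rhoS_univ_of_mem_tailF iseq hy]
  · intro σ h1 h2
    rw [map_mul, hKB σ h1 h2, act_Dem_of_disjoint _ _ _ hdisj.symm ⟨h1, h2⟩]
    exact act_psiIntegrand hd tl iseq mu
      fun x hx => h2 x (Finset.disjoint_left.mp hdisj hx)
  · intro x hx y hy hxy
    rw [rhoS_univ_of_mem_headF iseq hx, rhoS_univ_of_mem_headF iseq hy]
    simp only [hxy]
  · intro σ h1 h2
    rw [map_mul, hKA σ h1 h2, act_psiIntegrand hd tl iseq mu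
      fun x hx => h2 x (Finset.disjoint_right.mp hdisj hx)]

end

end QHL

open QKS Shuffle QHL in
/-- each `ψ^{𝐢,𝐚}_{μ(•)}` is a Laurent polynomial in the `x`-variables and
the arrow variables, symmetric in the variables at each vertex, and `ψ` is multiplicative
under concatenation of the data with respect to the shuffle product `*`:
`ψ^{𝐢,𝐚}_{μ(•)} = ψ^{𝐢′,𝐚′}_{μ′(•)} * ψ^{𝐢″,𝐚″}_{μ″(•)}`. -/
theorem stmt_15
    (Q0 Q1 : Type) [Fintype Q0] [DecidableEq Q0] [Fintype Q1] [DecidableEq Q1]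
    (hd tl : Q1 → Q0)
    (m' m'' : ℕ) (iseq : Fin (m' + m'') → Q0) (a : Fin (m' + m'') → ℕ) (ha : ∀ k, 0 < a k)
    (mu : Coord (m' + m'') a → ℤ) (hmu : BlockDecreasing mu) :
    psiF hd tl iseq a mu Finset.univ ∈ LaurentIn Q1 (Finset.univ : Finset (Coord (m' + m'') a)) ∧
    SymmOn Q1 (fun x => iseq x.1) Finset.univ (psiF hd tl iseq a mu Finset.univ) ∧
    psiF hd tl iseq a mu Finset.univ
      = starMul (fun x => iseq x.1) hd tl (fun x y => coordLT x y)
          (headF (m' + m'') a m') (tailF (m' + m'') a m')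
          (psiF hd tl iseq a mu (headF (m' + m'') a m'))
          (psiF hd tl iseq a mu (tailF (m' + m'') a m')) := by
  exact ⟨psiF_mem hd tl iseq mu, psiF_symmOn hd tl iseq mu _, psiF_univ hd tl iseq mu m'⟩
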